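/- Let s > 0 and let S ⊂ ℝ^d. Suppose that for every x ∈ S there exists d_x > 0 with the following property: for every 0 < μ ≤ d_x and every subset D ⊂ S ∩ B_μ(x), there exist finitely many balls B_{r₁}(x₁),…,B_{r_N}(x_N) with centers x_i ∈ D such that D ⊂ ∪_{i=1}^N B_{r_i}(x_i) and ∑_{i=1}^N r_i^s ≤ μ^s/2. Then H^s(S) = 0. -/

import Mathlib

open Metric Set MeasureTheory
open scoped ENNReal Topology

/-- `D` has a finite cover by balls centered in `D` of total `s`-content at most `a`. -/
def HasBallCover {X : Type*} [PseudoMetricSpace X] (s : ℝ) (D : Set X) (a : ℝ) : Prop :=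
  ∃ (ι : Type) (_ : Fintype ι) (c : ι → X) (r : ι → ℝ),
    (∀ i, c i ∈ D) ∧ (∀ i, 0 < r i) ∧ (D ⊆ ⋃ i, ball (c i) (r i)) ∧ ∑ i, (r i) ^ s ≤ a

/-- A covering property that gains a factor `1 / 2` in the `s`-content at all scales up to `δ`
can be iterated. -/
theorem HasBallCover.iterate {X : Type*} [PseudoMetricSpace X] {s δ : ℝ} (hs : 0 < s) {T : Set X}
    (h : ∀ x ∈ T, ∀ μ : ℝ, 0 < μ → μ ≤ δ → ∀ D ⊆ T ∩ ball x μ, HasBallCover s D (μ ^ s / 2))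
    (n : ℕ) : ∀ x ∈ T, ∀ μ : ℝ, 0 < μ → μ ≤ δ → ∀ D ⊆ T ∩ ball x μ,
      HasBallCover s D (μ ^ s / 2 ^ (n + 1)) := by
  induction n with
  | zero => simpa using h
  | succ n ih =>
    intro x hx μ hμ hμδ D hD
    obtain ⟨ι, _, c, r, hc, hr, hcov, hsum⟩ := h x hx μ hμ hμδ D hD
    have hrμ (i : ι) : r i ≤ μ := by
      refine (Real.rpow_le_rpow_iff (hr i).le hμ.le hs).1 ?_
      have hi : r i ^ s ≤ ∑ j, r j ^ s :=
        Finset.single_le_sum (fun j _ => Real.rpow_nonneg (hr j).le s) (Finset.mem_univ i)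
      linarith [Real.rpow_nonneg hμ.le s]
    choose κ hκ c' r' hc' hr' hcov' hsum' using fun i =>
      ih (c i) (hD (hc i)).1 (r i) (hr i) ((hrμ i).trans hμδ) (D ∩ ball (c i) (r i))
        (inter_subset_inter_left _ fun y hy => (hD hy).1)
    refine ⟨Σ i, κ i, inferInstance, fun p => c' p.1 p.2, fun p => r' p.1 p.2,
      fun p => (hc' p.1 p.2).1, fun p => hr' p.1 p.2, fun y hy => ?_, ?_⟩
    · obtain ⟨i, hi⟩ := mem_iUnion.1 (hcov hy)
      obtain ⟨j, hj⟩ := mem_iUnion.1 (hcov' i ⟨hy, hi⟩)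
      exact mem_iUnion.2 ⟨⟨i, j⟩, hj⟩
    · rw [Fintype.sum_sigma]
      calc ∑ i, ∑ j, r' i j ^ s ≤ ∑ i, r i ^ s / 2 ^ (n + 1) :=
            Finset.sum_le_sum fun i _ => hsum' i
        _ = (∑ i, r i ^ s) / 2 ^ (n + 1) := by rw [Finset.sum_div]
        _ ≤ μ ^ s / 2 / 2 ^ (n + 1) := by gcongr
        _ = μ ^ s / 2 ^ (n + 1 + 1) := by rw [div_div, pow_succ' 2 (n + 1)]

/-- A set with finite ball covers of arbitrarily small `s`-content is `μH[s]`-null. -/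
theorem hausdorffMeasure_eq_zero_of_hasBallCover {X : Type*} [MetricSpace X] [MeasurableSpace X]
    [BorelSpace X] {s : ℝ} (hs : 0 < s) {D : Set X} {a : ℕ → ℝ}
    (ha : Filter.Tendsto a Filter.atTop (𝓝 0)) (h : ∀ n, HasBallCover s D (a n)) :
    μH[s] D = 0 := by
  choose ι hι c r hc hr hcov hsum using h
  have hsum_nonneg (n : ℕ) : 0 ≤ ∑ i, r n i ^ s :=
    Finset.sum_nonneg fun i _ => Real.rpow_nonneg (hr n i).le s
  have ha0 (n : ℕ) : 0 ≤ a n := (hsum_nonneg n).trans (hsum n)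
  have hra (n : ℕ) (i : ι n) : r n i ≤ a n ^ s⁻¹ := by
    rw [Real.le_rpow_inv_iff_of_pos (hr n i).le (ha0 n) hs]
    exact (Finset.single_le_sum (fun j _ => Real.rpow_nonneg (hr n j).le s)
      (Finset.mem_univ i)).trans (hsum n)
  have hdiam (n : ℕ) (i : ι n) :
      ediam (ball (c n i) (r n i)) ≤ ENNReal.ofReal (2 * r n i) := by
    rw [← eball_ofReal, ENNReal.ofReal_mul zero_le_two, ENNReal.ofReal_ofNat]
    exact ediam_eball_le
  have hrad : Filter.Tendsto (fun n => ENNReal.ofReal (2 * a n ^ s⁻¹)) Filter.atTop (𝓝 0) := by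
    have := ((ha.rpow_const (p := s⁻¹) (Or.inr (by positivity))).const_mul 2)
    rw [Real.zero_rpow (by positivity), mul_zero] at this
    simpa using ENNReal.tendsto_ofReal this
  have hcontent :
      Filter.Tendsto (fun n => ENNReal.ofReal (2 ^ s * a n)) Filter.atTop (𝓝 0) := by
    simpa using ENNReal.tendsto_ofReal (ha.const_mul (2 ^ s))
  have hle (n : ℕ) :
      ∑ i, ediam (ball (c n i) (r n i)) ^ s ≤ ENNReal.ofReal (2 ^ s * a n) := by
    calc ∑ i, ediam (ball (c n i) (r n i)) ^ s
        ≤ ∑ i, ENNReal.ofReal (2 ^ s * r n i ^ s) := by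
          refine Finset.sum_le_sum fun i _ => ?_
          rw [← Real.mul_rpow zero_le_two (hr n i).le,
            ← ENNReal.ofReal_rpow_of_nonneg (mul_nonneg zero_le_two (hr n i).le) hs.le]
          exact ENNReal.rpow_le_rpow (hdiam n i) hs.le
      _ = ENNReal.ofReal (2 ^ s * ∑ i, r n i ^ s) := by
          rw [Finset.mul_sum, ENNReal.ofReal_sum_of_nonneg]
          exact fun i _ => mul_nonneg (by positivity) (Real.rpow_nonneg (hr n i).le s)
      _ ≤ ENNReal.ofReal (2 ^ s * a n) := by
          gcongr
          exact hsum n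
  refine le_antisymm ?_ zero_le
  calc μH[s] D
      ≤ Filter.liminf (fun n => ∑ i, ediam (ball (c n i) (r n i)) ^ s) Filter.atTop :=
        Measure.hausdorffMeasure_le_liminf_sum s D _ hrad (fun n i => ball (c n i) (r n i))
          (.of_forall fun n i => (hdiam n i).trans (by gcongr; exact hra n i))
          (.of_forall hcov)
    _ ≤ Filter.liminf (fun n => ENNReal.ofReal (2 ^ s * a n)) Filter.atTop :=
        Filter.liminf_le_liminf (.of_forall hle)
    _ = 0 := hcontent.liminf_eq

/-- A set on which the covering improvement holds at all scales up to a fixed `δ` is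
`μH[s]`-null. -/
theorem hausdorffMeasure_eq_zero_of_uniform_improvement {X : Type*} [MetricSpace X]
    [SecondCountableTopology X] [MeasurableSpace X] [BorelSpace X] {s δ : ℝ} (hs : 0 < s)
    (hδ : 0 < δ) {T : Set X}
    (h : ∀ x ∈ T, ∀ μ : ℝ, 0 < μ → μ ≤ δ → ∀ D ⊆ T ∩ ball x μ, HasBallCover s D (μ ^ s / 2)) :
    μH[s] T = 0 := by
  refine measure_null_of_locally_null T fun x hx =>
    ⟨T ∩ ball x δ, inter_mem_nhdsWithin T (ball_mem_nhds x hδ), ?_⟩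
  refine hausdorffMeasure_eq_zero_of_hasBallCover hs (a := fun n => δ ^ s / 2 ^ (n + 1)) ?_
    fun n => HasBallCover.iterate hs h n x hx δ hδ le_rfl _ subset_rfl
  exact Filter.Tendsto.div_atTop tendsto_const_nhds
    ((tendsto_pow_atTop_atTop_of_one_lt one_lt_two).comp (Filter.tendsto_add_atTop_nat 1))

/-- **Covering-improvement lemma.**  If every point `x` of `S ⊆ ℝ^d` has a scale `dx > 0`
such that any subset `D` of `S ∩ B_μ(x)` (for `0 < μ ≤ dx`) can be covered by finitely many
balls centered in `D` whose total `s`-content is at most `μ^s / 2`, then `H^s(S) = 0`. -/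
theorem covering_improvement_Hs_zero {d : ℕ} (s : ℝ) (hs : 0 < s)
    (S : Set (EuclideanSpace ℝ (Fin d)))
    (h : ∀ x ∈ S, ∃ dx > (0:ℝ), ∀ μ : ℝ, 0 < μ → μ ≤ dx →
      ∀ D ⊆ S ∩ ball x μ,
        ∃ (N : ℕ) (c : Fin N → EuclideanSpace ℝ (Fin d)) (r : Fin N → ℝ),
          (∀ i, c i ∈ D) ∧ (∀ i, 0 < r i) ∧ (D ⊆ ⋃ i, ball (c i) (r i)) ∧
          ∑ i, (r i) ^ s ≤ μ ^ s / 2) :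
    μH[s] S = 0 := by
  let T (n : ℕ) : Set (EuclideanSpace ℝ (Fin d)) :=
    {x ∈ S | ∀ μ : ℝ, 0 < μ → μ ≤ 1 / ((n : ℝ) + 1) → ∀ D ⊆ S ∩ ball x μ,
      HasBallCover s D (μ ^ s / 2)}
  have hST : S ⊆ ⋃ n, T n := by
    intro x hx
    obtain ⟨δ, hδ, hxδ⟩ := h x hx
    obtain ⟨n, hn⟩ := exists_nat_one_div_lt hδ
    refine mem_iUnion.2 ⟨n, hx, fun μ hμ hμn D hD => ?_⟩
    obtain ⟨N, c, r, hcover⟩ := hxδ μ hμ (hμn.trans hn.le) D hD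
    exact ⟨Fin N, inferInstance, c, r, hcover⟩
  refine measure_mono_null hST (measure_iUnion_null fun n => ?_)
  exact hausdorffMeasure_eq_zero_of_uniform_improvement hs (Nat.one_div_pos_of_nat (n := n))
    fun x hx μ hμ hμn D hD =>
      hx.2 μ hμ hμn D (hD.trans (inter_subset_inter_left _ (sep_subset _ _)))
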